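/- arXiv:1505.05800 — 4 statements merged into one kernel-verified Lean document; each statement's English description precedes it below -/
import Mathlib

section
/- Let n ≥ 1, K ≥ 1, t ≤ n, τ ≥ 0, and let J = (C_1, …, C_m) be a (t,τ)-pseudo-random K-formula over n variables. Then for every assignment ψ ∈ {±1}^n, the distribution D(J,ψ) is (t, n^t·τ)-close to the uniform distribution on {±1}^K. -/
/-- A `K`-tuple over `n` Boolean variables: `K` literals on `K` distinct variables. -/
def KTuple (n K : ℕ) : Type :=
  { p : (Fin K → Fin n) × (Fin K → ℤˣ) // Function.Injective p.1 }

/-- A partial `K`-tuple supported in `A ⊆ [K]`. -/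
def PartialTuple (n K : ℕ) (A : Finset (Fin K)) : Type :=
  { p : (↥A → Fin n) × (↥A → ℤˣ) // Function.Injective p.1 }

/-- Restriction of a `K`-tuple to the coordinates in `A`. -/
def KTuple.restrict {n K : ℕ} (C : KTuple n K) (A : Finset (Fin K)) :
    PartialTuple n K A :=
  ⟨(fun a => C.1.1 a.1, fun a => C.1.2 a.1), fun _ _ h => Subtype.ext (C.2 h)⟩

/-- Evaluation `C(ψ)_i = s_i · ψ_{v(i)}` of a `K`-tuple at an assignment `ψ ∈ {±1}^n`. -/
def KTuple.evalAt {n K : ℕ} (C : KTuple n K) (ψ : Fin n → ℤˣ) : Fin K → ℤˣ :=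
  fun i => C.1.2 i * ψ (C.1.1 i)

/-- The frequency `Fr_J(C)` of a partial `K`-tuple `C` in the formula `J`. -/
noncomputable def freq {n K : ℕ} {ι : Type} [Fintype ι] (J : ι → KTuple n K)
    {A : Finset (Fin K)} (C : PartialTuple n K A) : ℝ :=
  (Nat.card {j : ι // KTuple.restrict (J j) A = C} : ℝ) / (Fintype.card ι : ℝ)

/-- `p_{n,t} = 1/((2n)(2n−2)⋯(2n−2t+2))`. -/
noncomputable def pFreq (n t : ℕ) : ℝ :=
  1 / ∏ i ∈ Finset.range t, ((2 * n : ℝ) - 2 * i)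

/-- `J` is `(t,τ)`-pseudo-random. -/
def PseudoRandom {n K : ℕ} {ι : Type} [Fintype ι] (J : ι → KTuple n K)
    (t : ℕ) (τ : ℝ) : Prop :=
  ∀ A : Finset (Fin K), A.card ≤ t →
    ∀ C : PartialTuple n K A, |freq J C - pFreq n A.card| < τ

/-- Probability of the event `P` under a finitely supported distribution `D`. -/
noncomputable def prOf {α : Type*} [Fintype α] (D : α → ℝ) (P : Set α) : ℝ :=
  ∑ z, P.indicator D z

/-- A distribution `D` on `{±1}^K` is `(t,μ)`-close to the uniform distribution. -/
def CloseToUniform {K : ℕ} (D : (Fin K → ℤˣ) → ℝ) (t : ℕ) (μ : ℝ) : Prop :=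
  ∀ A : Finset (Fin K), A.card ≤ t → ∀ z : (↥A → ℤˣ),
    |prOf D {z' | ∀ a : ↥A, z' ↑a = z a} - (1 / 2 : ℝ) ^ A.card| ≤ μ

/-- The distribution `D(J,ψ)` of `C_j(ψ)` for uniform `j`. -/
noncomputable def formulaDist {n K m : ℕ} (J : Fin m → KTuple n K) (ψ : Fin n → ℤˣ) :
    (Fin K → ℤˣ) → ℝ :=
  fun w => (Nat.card {j : Fin m // KTuple.evalAt (J j) ψ = w} : ℝ) / m

theorem natCard_subtype_eq_sum {ι : Type*} [Fintype ι] (p : ι → Prop) [DecidablePred p] :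
    (Nat.card {j // p j} : ℝ) = ∑ j, if p j then 1 else 0 := by
  rw [Nat.card_eq_fintype_card, Fintype.card_subtype, Finset.sum_boole]

/-- The partial tuple on the variables `e` which takes the value `z` at the assignment `ψ`. -/
def PartialTuple.ofValue {n K : ℕ} {A : Finset (Fin K)} (ψ : Fin n → ℤˣ) (z : ↥A → ℤˣ)
    (e : ↥A ↪ Fin n) : PartialTuple n K A :=
  ⟨(e, fun a => z a * ψ (e a)), e.injective⟩

theorem KTuple.restrict_eq_ofValue_iff {n K : ℕ} {A : Finset (Fin K)} (ψ : Fin n → ℤˣ)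
    (z : ↥A → ℤˣ) (C : KTuple n K) (e : ↥A ↪ Fin n) :
    C.restrict A = PartialTuple.ofValue ψ z e ↔
      (⟨fun a => C.1.1 a, fun _ _ h => Subtype.ext (C.2 h)⟩ : ↥A ↪ Fin n) = e ∧
        ∀ a : ↥A, C.evalAt ψ a = z a := by
  have hval : ∀ x y w : ℤˣ, x = y * w ↔ x * w = y := fun x y w => by
    rw [← mul_inv_eq_iff_eq_mul, Int.units_inv_eq_self]
  constructor
  · intro h
    have hv : (fun a : ↥A => C.1.1 a) = e := congrArg (fun D => D.1.1) h
    have hs : (fun a : ↥A => C.1.2 a) = fun a => z a * ψ (e a) := congrArg (fun D => D.1.2) h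
    refine ⟨DFunLike.ext' hv, fun a => (hval _ _ _).1 ?_⟩
    exact (congrFun hs a).trans (congrArg (fun v => z a * ψ v) (congrFun hv a).symm)
  · rintro ⟨rfl, h⟩
    exact Subtype.ext (Prod.ext rfl (funext fun a => (hval _ _ _).2 (h a)))

theorem prOf_formulaDist {n K m : ℕ} (J : Fin m → KTuple n K) (ψ : Fin n → ℤˣ)
    (S : Set (Fin K → ℤˣ)) [DecidablePred (· ∈ S)] :
    prOf (formulaDist J ψ) S = (∑ j, if (J j).evalAt ψ ∈ S then (1 : ℝ) else 0) / m := by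
  classical
  have h (w : Fin K → ℤˣ) : S.indicator (formulaDist J ψ) w =
      (∑ j, if (J j).evalAt ψ = w then (if w ∈ S then (1 : ℝ) else 0) else 0) / m := by
    by_cases hw : w ∈ S <;> simp [hw, formulaDist, Fintype.card_subtype]
  simp only [prOf, h]
  rw [← Finset.sum_div, Finset.sum_comm]
  simp

theorem prOf_formulaDist_eq_sum_freq {n K m : ℕ} (J : Fin m → KTuple n K) (ψ : Fin n → ℤˣ)
    {A : Finset (Fin K)} (z : ↥A → ℤˣ) :
    prOf (formulaDist J ψ) {z' | ∀ a : ↥A, z' ↑a = z a} =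
      ∑ e : ↥A ↪ Fin n, freq J (PartialTuple.ofValue ψ z e) := by
  classical
  rw [prOf_formulaDist]
  simp only [freq, natCard_subtype_eq_sum, KTuple.restrict_eq_ofValue_iff, Fintype.card_fin]
  rw [← Finset.sum_div, Finset.sum_comm]
  simp [ite_and]

theorem descFactorial_mul_pFreq {n t : ℕ} (ht : t ≤ n) :
    (n.descFactorial t : ℝ) * pFreq n t = (1 / 2) ^ t := by
  have hprod : ∏ i ∈ Finset.range t, ((2 * n : ℝ) - 2 * i) = 2 ^ t * n.descFactorial t := by
    rw [Nat.descFactorial_eq_prod_range, Nat.cast_prod, ← Finset.card_range t,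
      ← Finset.prod_const, Finset.card_range, ← Finset.prod_mul_distrib]
    refine Finset.prod_congr rfl fun i hi => ?_
    rw [Nat.cast_sub ((Finset.mem_range.1 hi).le.trans ht)]
    ring
  have hne : (n.descFactorial t : ℝ) ≠ 0 := by
    simpa [Nat.descFactorial_eq_zero_iff_lt] using ht
  rw [pFreq, hprod, one_div_pow]
  field_simp

/-- if `J` is `(t,τ)`-pseudo-random then for every assignment `ψ ∈ {±1}^n`,
`D(J,ψ)` is `(t, n^t·τ)`-close to the uniform distribution on `{±1}^K`. -/
theorem stmt5 (n K m t : ℕ) (hn : 1 ≤ n) (hK : 1 ≤ K) (ht : t ≤ n) (hm : 1 ≤ m)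
    (τ : ℝ) (hτ : 0 ≤ τ) (J : Fin m → KTuple n K) (hJ : PseudoRandom J t τ)
    (ψ : Fin n → ℤˣ) :
    CloseToUniform (formulaDist J ψ) t ((n : ℝ) ^ t * τ) := by
  intro A hA z
  have hcard : Fintype.card (↥A ↪ Fin n) = n.descFactorial A.card := by
    simp [Fintype.card_embedding_eq]
  have hunif : (1 / 2 : ℝ) ^ A.card = ∑ _e : ↥A ↪ Fin n, pFreq n A.card := by
    rw [Finset.sum_const, Finset.card_univ, hcard, nsmul_eq_mul,
      descFactorial_mul_pFreq (hA.trans ht)]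
  rw [prOf_formulaDist_eq_sum_freq, hunif, ← Finset.sum_sub_distrib]
  calc |∑ e : ↥A ↪ Fin n, (freq J (PartialTuple.ofValue ψ z e) - pFreq n A.card)|
      ≤ ∑ e : ↥A ↪ Fin n, |freq J (PartialTuple.ofValue ψ z e) - pFreq n A.card| :=
        Finset.abs_sum_le_sum_abs _ _
    _ ≤ ∑ _e : ↥A ↪ Fin n, τ := Finset.sum_le_sum fun e _ => (hJ A hA _).le
    _ = n.descFactorial A.card * τ := by
        rw [Finset.sum_const, Finset.card_univ, hcard, nsmul_eq_mul]
    _ ≤ (n : ℝ) ^ t * τ := by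
        gcongr
        exact_mod_cast (Nat.descFactorial_le_pow n A.card).trans (Nat.pow_le_pow_right hn hA)
end

section
/- Let D be a probability distribution on {±1}^K that is (t,μ)-close to the uniform distribution, with μ ≥ 0, and let d be an integer with 1 ≤ d ≤ t, d ≤ K, and K·2^d·μ/d < d. Then there exists a real polynomial p : ℝ^K → ℝ of total degree at most d such that Pr_{z∼D}(p(z) ≠ XOR_K(z)) ≤ 2·exp(−D(1/2 + d/(2K), 1/2 + 2^{d−1}·μ/d)·K). -/
/-- Kullback–Leibler divergence between `Bernoulli p` and `Bernoulli q`. -/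
noncomputable def klBer (p q : ℝ) : ℝ :=
  p * Real.log (p / q) + (1 - p) * Real.log ((1 - p) / (1 - q))

/-- The generalized binomial coefficient `s (s - 1) ⋯ (s - k + 1) / k!` of a real number `s`. -/
noncomputable def realChoose (s : ℝ) (k : ℕ) : ℝ :=
  ∏ i ∈ Finset.range k, (s - i) / (i + 1)

lemma realChoose_succ (s : ℝ) (k : ℕ) :
    realChoose s (k + 1) = realChoose s k * ((s - k) / (k + 1)) := by
  rw [realChoose, realChoose, Finset.prod_range_succ]

lemma realChoose_succ_mul (s : ℝ) (k : ℕ) :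
    realChoose s (k + 1) * (k + 1) = s * realChoose (s - 1) k := by
  induction k with
  | zero => simp [realChoose]
  | succ k ih =>
    rw [realChoose_succ (s - 1), ← mul_assoc, ← ih, realChoose_succ s (k + 1)]
    have : (k : ℝ) + 1 ≠ 0 := by positivity
    push_cast
    have : (k : ℝ) + 1 + 1 ≠ 0 := by positivity
    field_simp
    ring

lemma realChoose_natCast (n k : ℕ) : realChoose n k = n.choose k := by
  induction k with
  | zero => simp [realChoose]
  | succ k ih =>
    rw [realChoose_succ, ih, mul_div_assoc', div_eq_iff (by positivity)]
    rcases le_or_gt k n with h | h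
    · have := Nat.choose_succ_right_eq n k
      rw [← Nat.cast_sub h]
      exact_mod_cast this.symm
    · simp [Nat.choose_eq_zero_of_lt h, Nat.choose_eq_zero_of_lt (h.trans k.lt_succ_self)]

lemma realChoose_pos {s : ℝ} {k : ℕ} (h : (k : ℝ) ≤ s) : 0 < realChoose s k := by
  refine Finset.prod_pos fun i hi => div_pos ?_ (by positivity)
  have : (i : ℝ) < k := by exact_mod_cast Finset.mem_range.1 hi
  linarith

lemma realChoose_mono {s r : ℝ} {k : ℕ} (h : (k : ℝ) ≤ s) (hsr : s ≤ r) :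
    realChoose s k ≤ realChoose r k := by
  refine Finset.prod_le_prod (fun i hi => div_nonneg ?_ (by positivity)) fun i hi => by gcongr
  have : (i : ℝ) < k := by exact_mod_cast Finset.mem_range.1 hi
  linarith

/-- The Taylor polynomial of `(1 + x) ^ s` of degree `⌊s⌋ + 1` is an upper bound for `x ≥ 0`. -/
lemma one_add_rpow_le_sum_realChoose (h : ℕ) {s x : ℝ} (hs : (h : ℝ) ≤ s) (hs' : s ≤ h + 1)
    (hx : 0 ≤ x) :
    (1 + x) ^ s ≤ ∑ k ∈ Finset.range (h + 2), realChoose s k * x ^ k := by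
  induction h generalizing s x with
  | zero =>
    have := rpow_one_add_le_one_add_mul_self (s := x) (by linarith) (p := s)
      (by simpa using hs) (by simpa using hs')
    simpa [Finset.sum_range_succ, realChoose] using this
  | succ h ih =>
    push_cast at hs hs'
    set F : ℝ → ℝ := fun y =>
      ∑ k ∈ Finset.range (h + 1 + 2), realChoose s k * y ^ k - (1 + y) ^ s with hF
    have hder : ∀ y : ℝ, 0 ≤ y → HasDerivAt F
        (∑ k ∈ Finset.range (h + 2), s * realChoose (s - 1) k * y ^ k
          - s * (1 + y) ^ (s - 1)) y := by
      intro y hy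
      have h1 : HasDerivAt (fun y : ℝ => (1 + y) ^ s) (s * (1 + y) ^ (s - 1)) y := by
        have := ((hasDerivAt_id y).const_add 1).rpow_const (p := s)
          (Or.inl (by simp only [id]; linarith))
        simpa using this
      have h2 : HasDerivAt (fun y : ℝ => ∑ k ∈ Finset.range (h + 1 + 2), realChoose s k * y ^ k)
          (∑ k ∈ Finset.range (h + 1 + 2), realChoose s k * (k * y ^ (k - 1))) y :=
        HasDerivAt.fun_sum fun k _ => (hasDerivAt_pow k y).const_mul _
      refine (h2.sub h1).congr_deriv (congrArg (· - _) ?_)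
      rw [Finset.sum_range_succ' _ (h + 2)]
      simp only [Nat.cast_zero, zero_mul, mul_zero, add_zero, Nat.add_sub_cancel]
      refine Finset.sum_congr rfl fun k _ => ?_
      rw [← realChoose_succ_mul]
      push_cast
      ring
    have hmono : MonotoneOn F (Set.Ici 0) := by
      refine monotoneOn_of_deriv_nonneg (convex_Ici 0)
        (fun y hy => (hder y hy).continuousAt.continuousWithinAt)
        (fun y hy => (hder y (interior_subset hy)).differentiableAt.differentiableWithinAt) ?_
      intro y hy
      have hy : 0 ≤ y := interior_subset hy
      rw [(hder y hy).deriv, sub_nonneg]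
      simp only [mul_assoc]
      rw [← Finset.mul_sum]
      have : (0 : ℝ) ≤ h := h.cast_nonneg
      exact mul_le_mul_of_nonneg_left (ih (by linarith) (by linarith) hy) (by linarith)
    have h0 : F 0 = 0 := by simp [hF, Finset.sum_range_succ', realChoose]
    have := hmono (Set.mem_Ici.2 le_rfl) (Set.mem_Ici.2 hx) hx
    rw [h0] at this
    simpa [hF] using this

/-- Among the first `d` moments, one yields a tail bound at least as good as the exponential
moment. -/
lemma exists_choose_mul_pow_mul_le (K d : ℕ) (hdK : d ≤ K) {q x : ℝ} (hq : 1 / 2 ≤ q)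
    (hx : 0 ≤ x) :
    ∃ k ≤ d, K.choose k * q ^ k * (1 + x) ^ (((K : ℝ) + d) / 2)
      ≤ (1 + q * x) ^ K * realChoose (((K : ℝ) + d) / 2) k := by
  have hdK' : (d : ℝ) ≤ K := by exact_mod_cast hdK
  set s : ℝ := ((K : ℝ) + d) / 2 with hs
  have hs0 : 0 ≤ s := by positivity
  obtain ⟨k₀, hk₀, hmin⟩ := Finset.exists_min_image (Finset.range (d + 1))
    (fun k => K.choose k * q ^ k / realChoose s k) ⟨0, by simp⟩
  simp only [Finset.mem_range, Nat.lt_succ_iff] at hk₀ hmin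
  have hpos : ∀ k ≤ d, 0 < realChoose s k := fun k hk => realChoose_pos (by
    have : (k : ℝ) ≤ d := by exact_mod_cast hk
    linarith)
  refine ⟨k₀, hk₀, ?_⟩
  set c : ℝ := K.choose k₀ * q ^ k₀ / realChoose s k₀ with hc
  have hc0 : 0 ≤ c := div_nonneg (by positivity) (hpos k₀ hk₀).le
  have hle : ∀ k ≤ d, c * realChoose s k ≤ K.choose k * q ^ k := fun k hk =>
    (le_div_iff₀ (hpos k hk)).1 (hmin k hk)
  have hfloor : (⌊s⌋₊ : ℝ) ≤ s := Nat.floor_le hs0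
  have hdfloor : d ≤ ⌊s⌋₊ := Nat.le_floor (by linarith)
  have hle' : ∀ k, d ≤ k → k ≤ ⌊s⌋₊ + 1 → c * realChoose s k ≤ K.choose k * q ^ k := by
    intro k hk
    induction k, hk using Nat.le_induction with
    | base => exact fun _ => hle d le_rfl
    | succ k hk ih =>
      intro hkf
      have hks : (k : ℝ) ≤ s :=
        le_trans (by exact_mod_cast Nat.le_of_succ_le_succ hkf) hfloor
      have hdk : (d : ℝ) ≤ k := by exact_mod_cast hk
      have hkK : (k : ℝ) ≤ K := by linarith
      have e : (K.choose (k + 1) : ℝ) = K.choose k * ((K - k) / (k + 1)) := by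
        rw [← realChoose_natCast, realChoose_succ, realChoose_natCast]
      rw [e, realChoose_succ]
      calc c * (realChoose s k * ((s - k) / (k + 1)))
          = (c * realChoose s k) * ((s - k) / (k + 1)) := by ring
        _ ≤ (K.choose k * q ^ k) * ((q * (K - k)) / (k + 1)) := by
            refine mul_le_mul (ih (by omega)) ?_ (div_nonneg (by linarith) (by positivity))
              (by positivity)
            gcongr
            nlinarith
        _ = _ := by ring
  have hsum : c * (1 + x) ^ s ≤ (1 + q * x) ^ K := by
    calc c * (1 + x) ^ s
        ≤ c * ∑ k ∈ Finset.range (⌊s⌋₊ + 2), realChoose s k * x ^ k := by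
          gcongr
          exact one_add_rpow_le_sum_realChoose _ hfloor (Nat.lt_floor_add_one s).le hx
      _ ≤ ∑ k ∈ Finset.range (⌊s⌋₊ + 2), K.choose k * (q * x) ^ k := by
          rw [Finset.mul_sum]
          refine Finset.sum_le_sum fun k hk => ?_
          have hk := Finset.mem_range.1 hk
          rw [mul_pow, ← mul_assoc, ← mul_assoc]
          refine mul_le_mul_of_nonneg_right ?_ (pow_nonneg hx k)
          rcases le_total k d with h | h
          · exact hle k h
          · exact hle' k h (by omega)
      _ ≤ ∑ k ∈ Finset.range (K + 2), K.choose k * (q * x) ^ k := by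
          refine Finset.sum_le_sum_of_subset_of_nonneg ?_ fun k _ _ => by positivity
          have : ⌊s⌋₊ ≤ K := Nat.floor_le_of_le (by linarith)
          exact Finset.range_subset_range.2 (by omega)
      _ = (1 + q * x) ^ K := by
          rw [Finset.sum_range_succ, add_comm 1, add_pow]
          simp [mul_comm]
  calc _ = c * (1 + x) ^ s * realChoose s k₀ := by
        rw [hc]; field_simp [(hpos k₀ hk₀).ne']
    _ ≤ _ := by gcongr; exact (hpos k₀ hk₀).le

lemma exp_neg_klBer_mul (n : ℕ) {p q : ℝ} (hq : 0 < q) (hqp : q < p) (hp : p < 1) :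
    (1 + q * (p * (1 - q) / (q * (1 - p)) - 1)) ^ n
      = Real.exp (-(klBer p q) * n) * (1 + (p * (1 - q) / (q * (1 - p)) - 1)) ^ (p * n) := by
  have hp0 : 0 < p := hq.trans hqp
  have hp1 : 0 < 1 - p := by linarith
  have hq1 : 0 < 1 - q := by linarith
  have e1 : 1 + q * (p * (1 - q) / (q * (1 - p)) - 1) = (1 - q) / (1 - p) := by
    field_simp; ring
  rw [e1, add_sub_cancel, Real.rpow_def_of_pos (by positivity), ← Real.exp_add,
    ← Real.rpow_natCast, Real.rpow_def_of_pos (by positivity), klBer]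
  rw [Real.log_div, Real.log_div, Real.log_div, Real.log_div, Real.log_mul, Real.log_mul]
  · congr 1; ring
  all_goals positivity

lemma prOf_union_le {α : Type*} [Fintype α] {D : α → ℝ} (hD : ∀ z, 0 ≤ D z) {P Q R : Set α}
    (h : P ⊆ Q ∪ R) : prOf D P ≤ prOf D Q + prOf D R := by
  rw [prOf, prOf, prOf, ← Finset.sum_add_distrib]
  refine Finset.sum_le_sum fun z _ => ?_
  have := hD z
  by_cases hP : z ∈ P
  · rcases h hP with hz | hz
    · rw [Set.indicator_of_mem hP, Set.indicator_of_mem hz]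
      linarith [Set.indicator_nonneg (s := R) (fun z _ => hD z) z]
    · rw [Set.indicator_of_mem hP, Set.indicator_of_mem hz]
      linarith [Set.indicator_nonneg (s := Q) (fun z _ => hD z) z]
  · rw [Set.indicator_of_notMem hP]
    exact add_nonneg (Set.indicator_nonneg (fun z _ => hD z) z)
      (Set.indicator_nonneg (fun z _ => hD z) z)

/-- Number of coordinates of `z` equal to `ε`. -/
def signCount {K : ℕ} (ε : ℤˣ) (z : Fin K → ℤˣ) : ℕ := (Finset.univ.filter (z · = ε)).card

lemma sum_mul_choose_signCount {K : ℕ} (D : (Fin K → ℤˣ) → ℝ) (ε : ℤˣ) (k : ℕ) :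
    ∑ z, D z * (signCount ε z).choose k
      = ∑ A ∈ Finset.powersetCard k (Finset.univ : Finset (Fin K)),
          prOf D {z : Fin K → ℤˣ | ∀ a : ↥A, z ↑a = ε} := by
  classical
  simp only [prOf]
  rw [Finset.sum_comm]
  refine Finset.sum_congr rfl fun z _ => ?_
  simp only [Set.indicator_apply, Set.mem_ofPred_eq]
  rw [← Finset.sum_filter, Finset.sum_const, nsmul_eq_mul, mul_comm, signCount,
    ← Finset.card_powersetCard]
  congr 3
  ext A
  simp [Finset.mem_powersetCard, Finset.subset_iff, and_comm]

lemma two_pow_mul_le (a d : ℕ) (h : 1 ≤ a) (had : a ≤ d) : d * 2 ^ a ≤ a * 2 ^ d := by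
  induction d, had using Nat.le_induction with
  | base => rfl
  | succ d hd ih =>
    have : d + 1 ≤ 2 * d := by omega
    calc (d + 1) * 2 ^ a ≤ 2 * d * 2 ^ a := by gcongr
      _ ≤ a * 2 ^ (d + 1) := by rw [pow_succ]; linarith

lemma half_pow_add_le (a d : ℕ) (h : 1 ≤ a) (had : a ≤ d) {μ : ℝ} (hμ : 0 ≤ μ) :
    (1 / 2 : ℝ) ^ a + μ ≤ (1 / 2 + 2 ^ (d - 1) * μ / d) ^ a := by
  have hd : 1 ≤ d := h.trans had
  have hd0 : (0 : ℝ) < d := by exact_mod_cast hd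
  set δ : ℝ := 2 ^ (d - 1) * μ / d with hδ
  have hδ0 : 0 ≤ δ := by positivity
  have hb := one_add_mul_le_pow (a := 2 * δ) (by linarith) a
  have e : (1 / 2 + δ) ^ a = (1 / 2) ^ a * (1 + 2 * δ) ^ a := by
    rw [← mul_pow]; ring
  have h2 : 2 * δ = 2 ^ d * μ / d := by
    obtain ⟨m, rfl⟩ := Nat.exists_eq_add_of_le' hd
    rw [hδ]; simp [pow_succ]; ring
  have hN : (d : ℝ) * 2 ^ a ≤ a * 2 ^ d := by exact_mod_cast two_pow_mul_le a d h had
  have h3 : μ ≤ (1 / 2) ^ a * (a * (2 * δ)) := by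
    rw [h2, one_div, inv_pow, ← div_eq_inv_mul, le_div_iff₀ (by positivity), mul_div_assoc',
      le_div_iff₀ hd0]
    nlinarith
  rw [e]
  calc _ ≤ (1 / 2) ^ a + (1 / 2) ^ a * (a * (2 * δ)) := by gcongr
    _ = (1 / 2) ^ a * (1 + a * (2 * δ)) := by ring
    _ ≤ _ := by gcongr

/-- Chernoff bound for distributions that are almost `d`-wise independent. -/
lemma prOf_le_signCount {K t d : ℕ} {μ : ℝ} (hμ : 0 ≤ μ) {D : (Fin K → ℤˣ) → ℝ}
    (hD : ∀ z, 0 ≤ D z) (hsum : ∑ z, D z = 1) (hclose : CloseToUniform D t μ)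
    (hd1 : 1 ≤ d) (hdt : d ≤ t) (hdK : d < K) (hcond : (K : ℝ) * 2 ^ d * μ / d < d) (ε : ℤˣ) :
    prOf D {z | ((K : ℝ) + d) / 2 ≤ signCount ε z}
      ≤ Real.exp (-(klBer (1 / 2 + d / (2 * K)) (1 / 2 + 2 ^ (d - 1) * μ / d)) * K) := by
  have hd0 : (0 : ℝ) < d := by exact_mod_cast hd1
  have hdK' : (d : ℝ) < K := by exact_mod_cast hdK
  have hK0 : (0 : ℝ) < K := hd0.trans hdK'
  set p : ℝ := 1 / 2 + d / (2 * K) with hp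
  set q : ℝ := 1 / 2 + 2 ^ (d - 1) * μ / d with hq
  set s : ℝ := ((K : ℝ) + d) / 2 with hs
  have hq2 : 1 / 2 ≤ q := by rw [hq]; linarith [show 0 ≤ 2 ^ (d - 1) * μ / d by positivity]
  have hpK : p * K = s := by rw [hp, hs]; field_simp
  have hp1 : p < 1 := by
    have : p * K < 1 * K := by linarith
    exact lt_of_mul_lt_mul_right this hK0.le
  have hqp : q < p := by
    have e : (K : ℝ) * 2 ^ d * μ / d = 2 * K * (2 ^ (d - 1) * μ / d) := by
      obtain ⟨m, rfl⟩ := Nat.exists_eq_add_of_le' hd1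
      simp [pow_succ]; ring
    rw [e] at hcond
    have : 2 ^ (d - 1) * μ / d < d / (2 * K) := by
      rw [lt_div_iff₀ (by positivity)]; linarith
    linarith
  have hq0 : 0 < q := by linarith
  set x : ℝ := p * (1 - q) / (q * (1 - p)) - 1 with hx
  have hx0 : 0 ≤ x := by
    rw [hx, sub_nonneg, one_le_div (mul_pos hq0 (by linarith))]
    nlinarith
  obtain ⟨k, hkd, hk⟩ := exists_choose_mul_pow_mul_le K d hdK.le hq2 hx0
  rw [exp_neg_klBer_mul K hq0 hqp hp1, hpK, ← hx] at hk
  have hkd' : (k : ℝ) ≤ d := by exact_mod_cast hkd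
  have hks : (k : ℝ) ≤ s := by linarith
  have hmarkov : realChoose s k * prOf D {z | s ≤ signCount ε z}
      ≤ ∑ z, D z * (signCount ε z).choose k := by
    rw [prOf, Finset.mul_sum]
    refine Finset.sum_le_sum fun z _ => ?_
    by_cases hz : z ∈ {z | s ≤ (signCount ε z : ℝ)}
    · rw [Set.indicator_of_mem hz, mul_comm, ← realChoose_natCast]
      exact mul_le_mul_of_nonneg_left (realChoose_mono hks hz) (hD z)
    · rw [Set.indicator_of_notMem hz, mul_zero]
      exact mul_nonneg (hD z) (Nat.cast_nonneg _)
  have hmoment : ∑ z, D z * (signCount ε z).choose k ≤ K.choose k * q ^ k := by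
    rcases Nat.eq_zero_or_pos k with rfl | hk1
    · simp [hsum]
    · rw [sum_mul_choose_signCount]
      refine (Finset.sum_le_card_nsmul _ _ (q ^ k) fun A hA => ?_).trans_eq (by simp)
      have hA : A.card = k := (Finset.mem_powersetCard.1 hA).2
      have h := (abs_le.1 (hclose A (by omega) fun _ => ε)).2
      rw [hA] at h
      linarith [half_pow_add_le k d hk1 hkd hμ]
  have hC := realChoose_pos hks
  have hx1 : 0 < (1 + x) ^ s := Real.rpow_pos_of_pos (by linarith) _
  refine le_of_mul_le_mul_left ?_ (mul_pos hC hx1)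
  nlinarith [mul_le_mul_of_nonneg_right (hmarkov.trans hmoment) hx1.le]

lemma totalDegree_aeval_le {σ : Type*} (P : MvPolynomial σ ℝ) (hP : P.totalDegree ≤ 1)
    (g : Polynomial ℝ) : (Polynomial.aeval P g).totalDegree ≤ g.natDegree := by
  rw [Polynomial.aeval_eq_sum_range]
  refine MvPolynomial.totalDegree_finsetSum_le fun i hi => ?_
  refine (MvPolynomial.totalDegree_smul_le _ _).trans
    ((MvPolynomial.totalDegree_pow _ _).trans ?_)
  have : i ≤ g.natDegree := Nat.lt_succ_iff.1 (Finset.mem_range.1 hi)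
  nlinarith

lemma signCount_add {K : ℕ} (z : Fin K → ℤˣ) : signCount 1 z + signCount (-1) z = K := by
  have := Finset.card_filter_add_card_filter_not (s := (Finset.univ : Finset (Fin K))) (z · = 1)
  simp only [Finset.card_univ, Fintype.card_fin] at this
  refine Eq.trans ?_ this
  rw [signCount, signCount]
  congr 2
  ext i
  rcases Int.units_eq_one_or (z i) with h | h <;> simp [h]

lemma sum_eq_signCount {K : ℕ} (z : Fin K → ℤˣ) :
    ∑ i, ((z i : ℤ) : ℝ) = K - 2 * signCount (-1) z := by
  have h : ∀ i, ((z i : ℤ) : ℝ) = 1 - 2 * (if z i = -1 then 1 else 0) := by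
    intro i
    rcases Int.units_eq_one_or (z i) with h | h <;> norm_num [h]
  rw [Finset.sum_congr rfl fun i _ => h i, Finset.sum_sub_distrib, ← Finset.mul_sum,
    Finset.sum_boole]
  simp [signCount]

lemma prod_eq_signCount {K : ℕ} (z : Fin K → ℤˣ) :
    ∏ i, ((z i : ℤ) : ℝ) = (-1) ^ signCount (-1) z := by
  have h : ∀ i, ((z i : ℤ) : ℝ) = if z i = -1 then -1 else 1 := by
    intro i
    rcases Int.units_eq_one_or (z i) with h | h <;> norm_num [h]
  rw [Finset.prod_congr rfl fun i _ => h i, Finset.prod_ite]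
  simp [signCount]

/-- Interpolating in the sum of the coordinates, a polynomial of degree `d` computes the parity of
all sign vectors whose coordinate sum is at most `d` in absolute value. -/
lemma exists_polynomial_eq_prod (K d : ℕ) (hdK : d ≤ K) :
    ∃ p : MvPolynomial (Fin K) ℝ, p.totalDegree ≤ d ∧ ∀ z : Fin K → ℤˣ,
      2 * signCount (-1) z ≤ K + d → 2 * signCount 1 z ≤ K + d →
      MvPolynomial.eval (fun i => ((z i : ℤ) : ℝ)) p = ∏ i, ((z i : ℤ) : ℝ) := by
  set T : Finset ℕ := Finset.Icc ((K - d + 1) / 2) ((K + d) / 2) with hT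
  set v : ℕ → ℝ := fun n => K - 2 * n with hv
  have hinj : Set.InjOn v T := by
    intro a _ b _ hab
    simp only [hv] at hab
    exact_mod_cast (by linarith : (a : ℝ) = b)
  set g := Lagrange.interpolate T v fun n => (-1) ^ n with hg
  have hdeg : g.natDegree ≤ d := by
    have h1 : g.degree < T.card := Lagrange.degree_interpolate_lt _ hinj
    have h2 : T.card ≤ d + 1 := by rw [hT, Nat.card_Icc]; omega
    rcases eq_or_ne g 0 with h0 | h0
    · simp [h0]
    · have := (Polynomial.natDegree_lt_iff_degree_lt h0).2 h1
      omega
  refine ⟨Polynomial.aeval (∑ i, MvPolynomial.X i) g,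
    (totalDegree_aeval_le _ ?_ g).trans hdeg, ?_⟩
  · exact MvPolynomial.totalDegree_finsetSum_le fun i _ => (MvPolynomial.totalDegree_X i).le
  · intro z h1 h2
    have hK := signCount_add z
    have hmem : signCount (-1) z ∈ T := by rw [hT, Finset.mem_Icc]; omega
    have e : MvPolynomial.eval (fun i => ((z i : ℤ) : ℝ))
        (Polynomial.aeval (∑ i, MvPolynomial.X i) g) = g.eval (v (signCount (-1) z)) := by
      rw [← MvPolynomial.coe_aeval_eq_eval, RingHom.coe_coe, ← Polynomial.aeval_algHom_apply,
        Polynomial.coe_aeval_eq_eval]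
      simp [hv, sum_eq_signCount]
    rw [e, Lagrange.eval_interpolate_at_node _ hinj hmem, prod_eq_signCount]

/-- if `D` is `(t,μ)`-close to uniform and `1 ≤ d ≤ min(t,K)` with
`K·2^d·μ/d < d`, then some polynomial of total degree `≤ d` disagrees with `XOR_K` with
probability at most `2·exp(−D(1/2 + d/(2K), 1/2 + 2^{d−1}μ/d)·K)`. -/
theorem stmt8 (K t d : ℕ) (μ : ℝ) (hμ : 0 ≤ μ) (D : (Fin K → ℤˣ) → ℝ)
    (hD : ∀ z, 0 ≤ D z) (hsum : ∑ z, D z = 1)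
    (hclose : CloseToUniform D t μ)
    (hd1 : 1 ≤ d) (hdt : d ≤ t) (hdK : d ≤ K)
    (hcond : (K : ℝ) * 2 ^ d * μ / d < d) :
    ∃ p : MvPolynomial (Fin K) ℝ, p.totalDegree ≤ d ∧
      prOf D {z | MvPolynomial.eval (fun i => ((z i : ℤ) : ℝ)) p ≠ ∏ i, ((z i : ℤ) : ℝ)}
        ≤ 2 * Real.exp
            (-(klBer (1 / 2 + d / (2 * K)) (1 / 2 + 2 ^ (d - 1) * μ / d)) * K) := by
  obtain ⟨p, hp, hpz⟩ := exists_polynomial_eq_prod K d hdK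
  refine ⟨p, hp, ?_⟩
  rcases hdK.lt_or_eq with hlt | rfl
  · refine (prOf_union_le hD (Q := {z | ((K : ℝ) + d) / 2 ≤ signCount 1 z})
      (R := {z | ((K : ℝ) + d) / 2 ≤ signCount (-1) z}) ?_).trans ?_
    · intro z hz
      by_contra hcon
      simp only [Set.mem_union, Set.mem_ofPred_eq, not_or, not_le] at hcon
      refine hz (hpz z ?_ ?_)
      · have : (2 * signCount (-1) z : ℝ) ≤ K + d := by linarith [hcon.2]
        exact_mod_cast this
      · have : (2 * signCount 1 z : ℝ) ≤ K + d := by linarith [hcon.1]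
        exact_mod_cast this
    · rw [two_mul]
      exact add_le_add (prOf_le_signCount hμ hD hsum hclose hd1 hdt hlt hcond 1)
        (prOf_le_signCount hμ hD hsum hclose hd1 hdt hlt hcond (-1))
  · have hempty : {z : Fin d → ℤˣ | MvPolynomial.eval (fun i => ((z i : ℤ) : ℝ)) p
        ≠ ∏ i, ((z i : ℤ) : ℝ)} = ∅ := by
      refine Set.eq_empty_of_forall_notMem fun z hz => hz ?_
      have := signCount_add z
      exact hpz z (by omega) (by omega)
    rw [hempty]
    simp only [prOf, Set.indicator_empty, Finset.sum_const_zero]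
    positivity
end

section
/- Let D be a probability distribution on {0,1}^q and let 0 < η < 1/2. Assume that for every A ⊆ [q], Pr_{z∼D}(z_i = 1 for all i ∈ A) ≤ η^{|A|}. Then Pr_{z∼D}(∑_{i=1}^q z_i ≥ q/2) ≤ exp(−D(1/2, η)·q) ≤ exp(−2·(1/2 − η)²·q). -/
lemma prod_ite_eq_pow_mul_indicator {q : ℕ} (a : ℝ) (A : Finset (Fin q)) (z : Fin q → Bool) :
    ∏ i ∈ A, (if z i then a else 0)
      = a ^ A.card * {z : Fin q → Bool | ∀ i ∈ A, z i = true}.indicator (fun _ => (1 : ℝ)) z := by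
  by_cases hz : ∀ i ∈ A, z i = true
  · rw [Set.indicator_of_mem (by exact hz), mul_one,
      Finset.prod_congr rfl (fun i hi => if_pos (hz i hi)), Finset.prod_const]
  · rw [Set.indicator_of_notMem (by exact hz), mul_zero]
    push Not at hz
    obtain ⟨i, hi, hzi⟩ := hz
    exact Finset.prod_eq_zero hi (if_neg hzi)

/-- A bound on the moment generating function of the number of ones: it is dominated by the
one of independent Bernoulli variables. -/
lemma sum_mul_prod_one_add_le {q : ℕ} {D : (Fin q → Bool) → ℝ} {η a : ℝ} (ha : 0 ≤ a)
    (h : ∀ A : Finset (Fin q), prOf D {z | ∀ i ∈ A, z i = true} ≤ η ^ A.card) :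
    ∑ z, D z * ∏ i, (1 + if z i then a else 0) ≤ (1 + a * η) ^ q := by
  have key : ∑ z, D z * ∏ i, (1 + if z i then a else 0)
      = ∑ A : Finset (Fin q), a ^ A.card * prOf D {z | ∀ i ∈ A, z i = true} := by
    simp_rw [Finset.prod_one_add, Finset.powerset_univ, prOf, Finset.mul_sum]
    rw [Finset.sum_comm]
    refine Finset.sum_congr rfl fun A _ => Finset.sum_congr rfl fun z _ => ?_
    rw [prod_ite_eq_pow_mul_indicator, mul_left_comm]
    by_cases hz : z ∈ {z : Fin q → Bool | ∀ i ∈ A, z i = true}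
    · rw [Set.indicator_of_mem hz, Set.indicator_of_mem hz, mul_one]
    · rw [Set.indicator_of_notMem hz, Set.indicator_of_notMem hz, mul_zero]
  have expand : (1 + a * η) ^ q = ∑ A : Finset (Fin q), a ^ A.card * η ^ A.card := by
    have := Finset.prod_one_add (f := fun _ : Fin q => a * η) Finset.univ
    simpa [mul_pow] using this
  rw [key, expand]
  exact Finset.sum_le_sum fun A _ => mul_le_mul_of_nonneg_left (h A) (pow_nonneg ha _)

lemma klBer_half {η : ℝ} (hη0 : 0 < η) (hη1 : η < 1) :
    klBer (1 / 2) η = -(Real.log (4 * (η * (1 - η)))) / 2 := by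
  have h1 : 0 < 1 - η := sub_pos.2 hη1
  have h4 : Real.log 4 = 2 * Real.log 2 := by
    rw [show (4 : ℝ) = 2 ^ 2 by norm_num, Real.log_pow]; norm_num
  have h2 : Real.log (1 / 2) = -Real.log 2 := by rw [one_div, Real.log_inv]
  rw [klBer, show (1 : ℝ) - 1 / 2 = 1 / 2 by norm_num, Real.log_div (by norm_num) hη0.ne',
    Real.log_div (by norm_num) h1.ne', Real.log_mul (by norm_num) (by positivity),
    Real.log_mul hη0.ne' h1.ne', h4, h2]
  ring

/-- Chernoff-type bound on `{0,1}^q`: if every conjunction of ones has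
probability at most `η^{|A|}`, then `Pr(∑ z_i ≥ q/2) ≤ exp(−D(1/2,η)q) ≤ exp(−2(1/2−η)²q)`. -/
theorem stmt10 (q : ℕ) (D : (Fin q → Bool) → ℝ) (hD : ∀ z, 0 ≤ D z) (hsum : ∑ z, D z = 1)
    (η : ℝ) (hη0 : 0 < η) (hη : η < 1 / 2)
    (h : ∀ A : Finset (Fin q), prOf D {z | ∀ i ∈ A, z i = true} ≤ η ^ A.card) :
    prOf D {z | (q : ℝ) / 2 ≤ ∑ i, (if z i then (1 : ℝ) else 0)}
        ≤ Real.exp (-(klBer (1 / 2) η) * q)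
      ∧ Real.exp (-(klBer (1 / 2) η) * q) ≤ Real.exp (-2 * (1 / 2 - η) ^ 2 * q) := by
  have h1 : 0 < 1 - η := by linarith
  constructor
  · set L := Real.log ((1 - η) / η) with hL
    have hLexp : Real.exp L = (1 - η) / η := Real.exp_log (by positivity)
    have hratio : 1 ≤ (1 - η) / η := by rw [le_div_iff₀ hη0]; linarith
    have hL0 : 0 ≤ L := Real.log_nonneg hratio
    have markov : prOf D {z | (q : ℝ) / 2 ≤ ∑ i, (if z i then (1 : ℝ) else 0)}
        ≤ Real.exp (-(L * (q / 2))) *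
          ∑ z, D z * ∏ i, (1 + if z i then (1 - η) / η - 1 else 0) := by
      rw [prOf, Finset.mul_sum]
      refine Finset.sum_le_sum fun z _ => ?_
      have hprod : ∏ i, (1 + if z i then (1 - η) / η - 1 else 0)
          = Real.exp (L * ∑ i, (if z i then (1 : ℝ) else 0)) := by
        rw [Finset.mul_sum, Real.exp_sum]
        refine Finset.prod_congr rfl fun i _ => ?_
        split_ifs <;> simp [hLexp]
      rw [hprod, mul_left_comm, ← Real.exp_add]
      refine Set.indicator_apply_le' (fun hz => ?_)
        (fun _ => mul_nonneg (hD z) (Real.exp_pos _).le)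
      refine le_mul_of_one_le_right (hD z) (Real.one_le_exp ?_)
      have := mul_le_mul_of_nonneg_left (show (q : ℝ) / 2 ≤ _ from hz) hL0
      linarith
    refine markov.trans ((mul_le_mul_of_nonneg_left
      (sum_mul_prod_one_add_le (sub_nonneg.2 hratio) h) (Real.exp_pos _).le).trans_eq ?_)
    have hbase : 1 + ((1 - η) / η - 1) * η = Real.exp (Real.log (2 * (1 - η))) := by
      rw [Real.exp_log (by positivity)]
      field_simp
      ring
    have h4 : Real.log 4 = 2 * Real.log 2 := by
      rw [show (4 : ℝ) = 2 ^ 2 by norm_num, Real.log_pow]; norm_num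
    rw [hbase, ← Real.exp_nat_mul, ← Real.exp_add, klBer_half hη0 (by linarith), hL,
      Real.log_div h1.ne' hη0.ne', Real.log_mul (by norm_num) h1.ne',
      Real.log_mul (by norm_num) (by positivity), Real.log_mul hη0.ne' h1.ne', h4]
    congr 1
    ring
  · rw [klBer_half hη0 (by linarith)]
    refine Real.exp_le_exp.2 (mul_le_mul_of_nonneg_right ?_ q.cast_nonneg)
    have := Real.log_le_sub_one_of_pos (show 0 < 4 * (η * (1 - η)) by positivity)
    linarith
end

section
/- Let q be odd, n ≥ 1, K ≥ 1, t ≤ n, τ ≥ 0, η ∈ [0,1], and let J = ((C_1,y_1), …, (C_m,y_m)) be a labeled (q,K)-formula over n variables (each C_j a (q,K)-tuple, y_j ∈ {±1}). Suppose the K-formula consisting of all mq constituent K-tuples of J is (t,τ)-pseudo-random, that d is an integer with 1 ≤ d ≤ t, d ≤ K and K·2^d·n^d·τ/d < d, and that there exists ψ ∈ {±1}^n with |{j ∈ [m] : MXOR_{q,K}(C_j(ψ)) = y_j}|/m ≥ 1 − η. Then there exists a real polynomial p' : ℝ^{nqK} → ℝ of total degree at most d such that |{j ∈ [m] : sign(p'(π(C_j)))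 ≠ y_j}|/m ≤ η + 2q·exp(−D(1/2 + d/(2K), 1/2 + 2^{d−1}·n^d·τ/d)·K). -/
/-- `sign(x) = 1` if `x > 0` and `−1` otherwise. -/
noncomputable def rsign (x : ℝ) : ℝ := if 0 < x then 1 else -1

/-- `π : X_{n,K} → {−1,0,1}^{nK}`: concatenation of signed indicator vectors of the literals. -/
noncomputable def piMap {n K : ℕ} (C : KTuple n K) : Fin K × Fin n → ℝ :=
  fun p => if C.1.1 p.1 = p.2 then ((C.1.2 p.1 : ℤ) : ℝ) else 0

/-- `XOR_K(C(ψ)) = ∏_i C(ψ)_i`, as a real number. -/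
noncomputable def xorVal {n K : ℕ} (C : KTuple n K) (ψ : Fin n → ℤˣ) : ℝ :=
  ∏ i, ((KTuple.evalAt C ψ i : ℤ) : ℝ)

open Finset

/-- Logarithm of the Chernoff bound for `Q` successes among `P` trials of success probability `α`,
with real-valued `P` and `Q`. -/
noncomputable def chernoffLog (α P Q : ℝ) : ℝ :=
  Q * Real.log (α * P / Q) + (P - Q) * Real.log ((1 - α) * P / (P - Q))

lemma mul_log_one_add_div_mono {h x y : ℝ} (hh : 0 ≤ h) (hx : 0 < x) (hxy : x ≤ y) :
    x * Real.log ((x + h) / x) ≤ y * Real.log ((y + h) / y) := by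
  have hy : 0 < y := hx.trans_le hxy
  have hb := one_add_mul_self_le_rpow_one_add (s := h / y) (p := y / x)
    (by have : 0 ≤ h / y := by positivity
        linarith) ((one_le_div hx).2 hxy)
  have e1 : 1 + y / x * (h / y) = (x + h) / x := by field_simp
  have e2 : 1 + h / y = (y + h) / y := by field_simp
  rw [e1, e2] at hb
  have hl := Real.log_le_log (by positivity) hb
  rw [Real.log_rpow (by positivity)] at hl
  calc x * Real.log ((x + h) / x) ≤ x * (y / x * Real.log ((y + h) / y)) :=
        mul_le_mul_of_nonneg_left hl hx.le
    _ = _ := by field_simp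

lemma chernoffLog_sub_le {α P Q h : ℝ} (hα : 0 < α) (hα1 : α < 1) (hh : 0 ≤ h) (hQ : h < Q)
    (hQP : Q < P) :
    h * Real.log (α * P / Q) + chernoffLog α (P - h) (Q - h) ≤ chernoffLog α P Q := by
  have key := mul_log_one_add_div_mono hh (sub_pos.2 hQ) (sub_le_sub_right hQP.le h)
  have a1 : 1 - α ≠ 0 := by linarith
  have a2 : P ≠ 0 := by linarith
  have a3 : Q ≠ 0 := by linarith
  have a4 : P - h ≠ 0 := by linarith
  have a5 : Q - h ≠ 0 := by linarith
  have a6 : P - Q ≠ 0 := by linarith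
  have a7 : P - h - (Q - h) = P - Q := by ring
  rw [sub_add_cancel, sub_add_cancel, Real.log_div a3 a5, Real.log_div a2 a4] at key
  unfold chernoffLog
  rw [a7, Real.log_div (mul_ne_zero hα.ne' a2) a3, Real.log_mul hα.ne' a2,
    Real.log_div (mul_ne_zero hα.ne' a4) a5, Real.log_mul hα.ne' a4,
    Real.log_div (mul_ne_zero a1 a4) a6, Real.log_mul a1 a4,
    Real.log_div (mul_ne_zero a1 a2) a6, Real.log_mul a1 a2]
  linarith

lemma chernoffLog_of_eq {α P Q : ℝ} (hα : α < 1) (hP : 0 < P) (hQ : Q = α * P) :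
    chernoffLog α P Q = 0 := by
  subst hQ
  unfold chernoffLog
  have h1 : P - α * P = (1 - α) * P := by ring
  have h2 : (1 - α) * P ≠ 0 := mul_ne_zero (by linarith) hP.ne'
  rw [h1, div_self h2]
  rcases eq_or_ne (α * P) 0 with h | h
  · simp [h]
  · simp [div_self h]

/-- The Chernoff bound is attained by a ratio of falling factorials of integral order. -/
lemma exists_prod_le_exp_chernoffLog {α : ℝ} (hα : 0 < α) (hα1 : α < 1) (d : ℕ) (P Q : ℝ)
    (hdQ : d < Q) (hQP : Q < P) (hd : Q - d ≤ α * (P - d)) (hPQ : α * P ≤ Q) :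
    ∃ k ≤ d, ∏ i ∈ range k, (α * (P - i)) ≤
      Real.exp (chernoffLog α P Q) * ∏ i ∈ range k, (Q - i) := by
  induction d generalizing P Q with
  | zero =>
    have hQ : Q = α * P := by
      simp only [Nat.cast_zero, sub_zero] at hd
      exact le_antisymm hd hPQ
    have h0 : (0 : ℝ) < Q := by simpa using hdQ
    exact ⟨0, le_rfl, by simp [chernoffLog_of_eq hα1 (h0.trans hQP) hQ]⟩
  | succ d ih =>
    push_cast at hdQ hd
    have hd0 : (0 : ℝ) ≤ d := d.cast_nonneg
    have hQ0 : 0 < Q := by linarith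
    have hP0 : 0 < P := by linarith
    have hr : 0 < α * P / Q := by positivity
    have hexp : Real.exp (Real.log (α * P / Q)) * Q = α * P := by
      rw [Real.exp_log hr]
      field_simp
    by_cases hc : α * (P - 1) ≤ Q - 1
    · obtain ⟨k, hk, hle⟩ := ih (P - 1) (Q - 1) (by linarith) (by linarith) (by linarith) hc
      refine ⟨k + 1, by omega, ?_⟩
      have hpos : 0 ≤ ∏ i ∈ range k, (Q - 1 - i) := by
        refine prod_nonneg fun i hi => ?_
        have : (i : ℝ) ≤ d := by
          exact_mod_cast (mem_range.1 hi).le.trans hk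
        linarith
      have hs := chernoffLog_sub_le hα hα1 zero_le_one (by linarith) hQP
      rw [one_mul] at hs
      rw [prod_range_succ', prod_range_succ']
      simp only [Nat.cast_add, Nat.cast_one, Nat.cast_zero, sub_zero]
      have e1 : ∀ x : ℝ, ∀ i : ℕ, x - ((i : ℝ) + 1) = x - 1 - i := fun x i => by ring
      simp only [e1]
      calc (∏ i ∈ range k, α * (P - 1 - i)) * (α * P)
          ≤ (Real.exp (chernoffLog α (P - 1) (Q - 1)) * ∏ i ∈ range k, (Q - 1 - i)) * (α * P) :=
            mul_le_mul_of_nonneg_right hle (by positivity)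
        _ = Real.exp (Real.log (α * P / Q) + chernoffLog α (P - 1) (Q - 1)) *
              ((∏ i ∈ range k, (Q - 1 - i)) * Q) := by
            conv_lhs => rw [← hexp]
            rw [Real.exp_add]
            ring
        _ ≤ _ := mul_le_mul_of_nonneg_right (Real.exp_le_exp.2 hs) (mul_nonneg hpos hQ0.le)
    · push Not at hc
      refine ⟨1, by omega, ?_⟩
      simp only [prod_range_one, Nat.cast_zero, sub_zero]
      have hα' : 0 < 1 - α := by linarith
      set h := (Q - α * P) / (1 - α) with hh
      have hmul : h * (1 - α) = Q - α * P := by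
        rw [hh]
        field_simp
      have h0 : 0 ≤ h := div_nonneg (by linarith) hα'.le
      have h1 : h ≤ 1 := (div_le_one hα').2 (by linarith)
      have hs := chernoffLog_sub_le hα hα1 h0 (by linarith) hQP
      rw [chernoffLog_of_eq hα1 (P := P - h) (by linarith) (by linarith), add_zero] at hs
      have hl : Real.log (α * P / Q) ≤ 0 :=
        Real.log_nonpos hr.le ((div_le_one hQ0).2 hPQ)
      rw [← hexp]
      refine mul_le_mul_of_nonneg_right (Real.exp_le_exp.2 (le_trans ?_ hs)) hQ0.le
      nlinarith

lemma neg_klBer_mul_eq_chernoffLog {α P Q : ℝ} (hP : P ≠ 0) :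
    -(klBer (Q / P) α) * P = chernoffLog α P Q := by
  unfold klBer chernoffLog
  have e : 1 - Q / P = (P - Q) / P := by field_simp
  have e1 : α * P / Q = (Q / P / α)⁻¹ := by
    rw [inv_div, div_div_eq_mul_div]
  have e2 : (1 - α) * P / (P - Q) = ((P - Q) / P / (1 - α))⁻¹ := by
    rw [inv_div, div_div_eq_mul_div]
  rw [e, e1, e2, Real.log_inv, Real.log_inv]
  field_simp
  ring

section Tuples

variable {n K : ℕ} {ι : Type} [Fintype ι]

/-- The number of literals of `C` satisfied by `ψ`. -/
def KTuple.numTrue (C : KTuple n K) (ψ : Fin n → ℤˣ) : ℕ :=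
  #{i | C.evalAt ψ i = 1}

lemma KTuple.evalAt_eq_one_iff (C : KTuple n K) (ψ : Fin n → ℤˣ) (i : Fin K) :
    C.evalAt ψ i = 1 ↔ C.1.2 i = ψ (C.1.1 i) := by
  unfold KTuple.evalAt
  rcases Int.units_eq_one_or (C.1.2 i) with h | h <;>
  rcases Int.units_eq_one_or (ψ (C.1.1 i)) with h' | h' <;> simp [h, h']

lemma KTuple.evalAt_neg (C : KTuple n K) (ψ : Fin n → ℤˣ) (i : Fin K) :
    C.evalAt (-ψ) i = -C.evalAt ψ i := by
  simp [KTuple.evalAt]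

lemma KTuple.numTrue_add_numTrue_neg (C : KTuple n K) (ψ : Fin n → ℤˣ) :
    C.numTrue ψ + C.numTrue (-ψ) = K := by
  have h : ∀ i, C.evalAt (-ψ) i = 1 ↔ ¬ C.evalAt ψ i = 1 := fun i => by
    rw [C.evalAt_neg]
    rcases Int.units_eq_one_or (C.evalAt ψ i) with h | h <;> simp [h]
  unfold KTuple.numTrue
  simp only [h]
  rw [Finset.card_filter_add_card_filter_not, card_univ, Fintype.card_fin]

lemma KTuple.evalAt_eq_ite (C : KTuple n K) (ψ : Fin n → ℤˣ) (i : Fin K) :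
    C.evalAt ψ i = if C.evalAt (-ψ) i = 1 then -1 else 1 := by
  rw [C.evalAt_neg]
  rcases Int.units_eq_one_or (C.evalAt ψ i) with h | h <;> simp [h]

lemma xorVal_eq (C : KTuple n K) (ψ : Fin n → ℤˣ) :
    xorVal C ψ = (-1) ^ C.numTrue (-ψ) := by
  have h : ∀ i, ((C.evalAt ψ i : ℤ) : ℝ) = if C.evalAt (-ψ) i = 1 then -1 else 1 := fun i => by
    rw [C.evalAt_eq_ite]
    split_ifs <;> simp
  unfold xorVal KTuple.numTrue
  simp only [h]
  rw [prod_ite]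
  simp

lemma sum_evalAt_eq (C : KTuple n K) (ψ : Fin n → ℤˣ) :
    ∑ i, ((C.evalAt ψ i : ℤ) : ℝ) = K - 2 * C.numTrue (-ψ) := by
  have h : ∀ i, ((C.evalAt ψ i : ℤ) : ℝ) =
      1 - 2 * if C.evalAt (-ψ) i = 1 then 1 else 0 := fun i => by
    rw [C.evalAt_eq_ite]
    split_ifs <;> norm_num
  unfold KTuple.numTrue
  simp only [h]
  rw [sum_sub_distrib, ← mul_sum, sum_boole]
  simp

lemma sum_piMap_mul (C : KTuple n K) (ψ : Fin n → ℤˣ) :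
    ∑ i : Fin K × Fin n, ((ψ i.2 : ℤ) : ℝ) * piMap C i = ∑ i, ((C.evalAt ψ i : ℤ) : ℝ) := by
  rw [Fintype.sum_prod_type]
  refine sum_congr rfl fun i _ => ?_
  simp [piMap, KTuple.evalAt, mul_comm]

lemma pFreq_eq {k : ℕ} (hk : k ≤ n) :
    pFreq n k = 1 / (2 ^ k * (n.descFactorial k : ℝ)) := by
  unfold pFreq
  congr 1
  rw [Nat.descFactorial_eq_prod_range, Nat.cast_prod]
  have h2 : (2 : ℝ) ^ k = ∏ _i ∈ range k, (2 : ℝ) := by simp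
  rw [h2, ← prod_mul_distrib]
  refine prod_congr rfl fun i hi => ?_
  rw [Nat.cast_sub ((mem_range.1 hi).le.trans hk)]
  ring

/-- In a pseudo-random formula, a given set of `k` coordinates is simultaneously satisfied by `ψ`
with frequency at most `2⁻ᵏ + nᵏ τ`. -/
lemma PseudoRandom.card_forall_le {J : ι → KTuple n K} {t : ℕ} {τ : ℝ} (hτ : 0 ≤ τ)
    (hJ : PseudoRandom J t τ) (htn : t ≤ n) (ψ : Fin n → ℤˣ) (A : Finset (Fin K))
    (hA : #A ≤ t) :
    (#{j | ∀ i ∈ A, (J j).evalAt ψ i = 1} : ℝ) ≤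
      Fintype.card ι * ((1 / 2) ^ #A + n ^ #A * τ) := by
  classical
  rcases isEmpty_or_nonempty ι with hι | hι
  · simp
  have hN : (0 : ℝ) < Fintype.card ι := by exact_mod_cast Fintype.card_pos
  let T : (A ↪ Fin n) → PartialTuple n K A := fun v => ⟨(v, fun a => ψ (v a)), v.injective⟩
  have hsub : ({j | ∀ i ∈ A, (J j).evalAt ψ i = 1} : Finset ι) ⊆
      univ.biUnion fun v : A ↪ Fin n => {j | (J j).restrict A = T v} := by
    intro j hj
    simp only [mem_filter, mem_univ, true_and] at hj
    simp only [mem_biUnion, mem_filter, mem_univ, true_and]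
    refine ⟨⟨fun a => (J j).1.1 a.1, fun _ _ h => Subtype.ext ((J j).2 h)⟩, ?_⟩
    refine Subtype.ext (Prod.ext rfl ?_)
    funext a
    exact ((J j).evalAt_eq_one_iff ψ a.1).1 (hj a.1 a.2)
  have hcard : ∀ v : A ↪ Fin n, (#{j | (J j).restrict A = T v} : ℝ) ≤
      Fintype.card ι * (pFreq n #A + τ) := fun v => by
    have h := (abs_lt.1 (hJ A hA (T v))).2
    unfold freq at h
    rw [Nat.card_eq_fintype_card, Fintype.card_subtype] at h
    have h' := (div_lt_iff₀ hN).1 (sub_lt_iff_lt_add.1 h)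
    linarith
  have hk : #A ≤ n := hA.trans htn
  have hD : (0 : ℝ) < n.descFactorial #A := by
    exact_mod_cast Nat.descFactorial_pos.2 hk
  calc (#{j | ∀ i ∈ A, (J j).evalAt ψ i = 1} : ℝ)
      ≤ ∑ v : A ↪ Fin n, (#{j | (J j).restrict A = T v} : ℝ) := by
        exact_mod_cast (card_le_card hsub).trans card_biUnion_le
    _ ≤ ∑ _v : A ↪ Fin n, Fintype.card ι * (pFreq n #A + τ) := sum_le_sum fun v _ => hcard v
    _ = Fintype.card ι * ((1 / 2) ^ #A + n.descFactorial #A * τ) := by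
        rw [sum_const, card_univ, Fintype.card_embedding_eq, Fintype.card_fin, Fintype.card_coe,
          nsmul_eq_mul, pFreq_eq hk, one_div_pow]
        field_simp
    _ ≤ _ := by
        have : (n.descFactorial #A : ℝ) ≤ n ^ #A := by
          exact_mod_cast Nat.descFactorial_le_pow n #A
        gcongr

lemma half_pow_add_le_s13 {d k : ℕ} {τ : ℝ} (hn : 1 ≤ n) (hτ : 0 ≤ τ) (hd : 1 ≤ d)
    (hk : k ≤ d) (hk0 : 1 ≤ k) :
    (1 / 2 : ℝ) ^ k + n ^ k * τ ≤ (1 / 2 + 2 ^ (d - 1) * (n : ℝ) ^ d * τ / d) ^ k := by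
  obtain ⟨j, rfl⟩ := Nat.exists_eq_add_of_le hk
  have hn' : (1 : ℝ) ≤ n := by exact_mod_cast hn
  have hk0' : (1 : ℝ) ≤ k := by exact_mod_cast hk0
  have hpow : (2 : ℝ) ^ (k + j - 1) = 2 ^ k * 2 ^ j / 2 := by
    rw [eq_div_iff two_ne_zero, ← pow_succ, ← pow_add]
    congr 1
    omega
  set ε : ℝ := 2 ^ (k + j - 1) * (n : ℝ) ^ (k + j) * τ / ((k + j : ℕ) : ℝ) with hε
  have hε0 : 0 ≤ ε := by positivity
  have hb := one_add_mul_le_pow (a := 2 * ε) (by linarith) k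
  have hj : (k + j : ℝ) ≤ k * 2 ^ j := by
    have h1 := one_add_mul_le_pow (a := (1 : ℝ)) (by norm_num) j
    norm_num at h1
    nlinarith [(Nat.cast_nonneg j : (0 : ℝ) ≤ j)]
  have hnj : (1 : ℝ) ≤ n ^ j := one_le_pow₀ hn'
  have hmain : (n : ℝ) ^ k * τ ≤ (1 / 2) ^ k * (k * (2 * ε)) := by
    have e : (1 / 2 : ℝ) ^ k * (k * (2 * ε)) = n ^ k * τ * (k * 2 ^ j * n ^ j / (k + j)) := by
      rw [hε, hpow, pow_add, one_div, inv_pow]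
      push_cast
      field_simp
    rw [e]
    refine le_mul_of_one_le_right (by positivity) ?_
    rw [one_le_div (by positivity)]
    exact hj.trans (le_mul_of_one_le_right (by positivity) hnj)
  calc (1 / 2 : ℝ) ^ k + n ^ k * τ ≤ (1 / 2) ^ k * (1 + k * (2 * ε)) := by linarith
    _ ≤ (1 / 2) ^ k * (1 + 2 * ε) ^ k := by gcongr
    _ = _ := by
        rw [← mul_pow]
        congr 1
        ring

/-- Falling factorial moments of the number of satisfied literals. -/
lemma sum_descFactorial_numTrue_le {J : ι → KTuple n K} {k : ℕ} {c : ℝ} (ψ : Fin n → ℤˣ)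
    (h : ∀ A : Finset (Fin K), #A = k → (#{j | ∀ i ∈ A, (J j).evalAt ψ i = 1} : ℝ) ≤ c) :
    ∑ j, (((J j).numTrue ψ).descFactorial k : ℝ) ≤ K.descFactorial k * c := by
  classical
  have hcount : ∑ j, ((J j).numTrue ψ).choose k =
      ∑ A ∈ powersetCard k (univ : Finset (Fin K)), #{j | ∀ i ∈ A, (J j).evalAt ψ i = 1} := by
    simp only [card_filter]
    rw [sum_comm]
    refine sum_congr rfl fun j _ => ?_
    rw [← card_filter, KTuple.numTrue, ← card_powersetCard]
    congr 1
    ext A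
    simp only [mem_powersetCard, mem_filter, subset_univ, true_and]
    rw [and_comm]
    simp [subset_iff]
  have hch : ∑ j, (((J j).numTrue ψ).choose k : ℝ) ≤ K.choose k * c := by
    rw [← Nat.cast_sum, hcount, Nat.cast_sum]
    refine (sum_le_card_nsmul _ _ c fun A hA => h A (mem_powersetCard.1 hA).2).trans_eq ?_
    simp
  simp only [Nat.descFactorial_eq_factorial_mul_choose, Nat.cast_mul]
  rw [← mul_sum, mul_assoc]
  exact mul_le_mul_of_nonneg_left hch (by positivity)

lemma prod_sub_le_descFactorial {k x : ℕ} {Q : ℝ} (hkQ : k ≤ Q) (hx : Q ≤ x) :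
    ∏ i ∈ range k, (Q - i) ≤ (x.descFactorial k : ℝ) := by
  rw [Nat.descFactorial_eq_prod_range, Nat.cast_prod]
  have hi : ∀ i ∈ range k, (i : ℝ) ≤ Q := fun i hi =>
    le_trans (by exact_mod_cast (mem_range.1 hi).le) hkQ
  refine prod_le_prod (fun i h => sub_nonneg.2 (hi i h)) fun i h => ?_
  rw [Nat.cast_sub (by exact_mod_cast (hi i h).trans hx)]
  linarith

/-- Chernoff bound for the number of satisfied literals in a pseudo-random formula. -/
lemma PseudoRandom.card_numTrue_ge_le {J : ι → KTuple n K} {t d : ℕ} {τ : ℝ} (hn : 1 ≤ n)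
    (hτ : 0 ≤ τ) (hJ : PseudoRandom J t τ) (htn : t ≤ n) (hd1 : 1 ≤ d) (hdt : d ≤ t)
    (hdK : d ≤ K) (hcond : (K : ℝ) * 2 ^ d * (n : ℝ) ^ d * τ / d < d) (ψ : Fin n → ℤˣ) :
    (#{j | K + d ≤ 2 * (J j).numTrue ψ} : ℝ) ≤ Fintype.card ι *
      Real.exp (-(klBer (1 / 2 + d / (2 * K))
        (1 / 2 + 2 ^ (d - 1) * (n : ℝ) ^ d * τ / d)) * K) := by
  have hK0 : (0 : ℝ) < K := by exact_mod_cast hd1.trans hdK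
  have hd0 : (0 : ℝ) < d := by exact_mod_cast hd1
  have hdK' : (d : ℝ) ≤ K := by exact_mod_cast hdK
  have hmoment : ∀ k, 1 ≤ k → k ≤ d → _ := fun k hk0 hk =>
    sum_descFactorial_numTrue_le (J := J) (k := k) (c := Fintype.card ι *
      (1 / 2 + 2 ^ (d - 1) * (n : ℝ) ^ d * τ / d) ^ k) ψ fun A hA =>
        (hJ.card_forall_le hτ htn ψ A (by omega)).trans
          (mul_le_mul_of_nonneg_left (by
            rw [hA]
            exact half_pow_add_le_s13 hn hτ hd1 hk hk0) (by positivity))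
  have hε0 : 0 ≤ 2 ^ (d - 1) * (n : ℝ) ^ d * τ / d := by positivity
  have hε : 2 * K * (2 ^ (d - 1) * (n : ℝ) ^ d * τ / d) < d := by
    refine lt_of_eq_of_lt ?_ hcond
    obtain ⟨e, rfl⟩ := Nat.exists_eq_add_of_le' hd1
    rw [Nat.add_sub_cancel, pow_succ (2 : ℝ)]
    ring
  have hβ : (1 / 2 + d / (2 * K) : ℝ) = ((K + d) / 2) / K := by
    field_simp
  rw [hβ, neg_klBer_mul_eq_chernoffLog hK0.ne']
  set α : ℝ := 1 / 2 + 2 ^ (d - 1) * (n : ℝ) ^ d * τ / d with hα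
  generalize 2 ^ (d - 1) * (n : ℝ) ^ d * τ / d = ε at hε hε0 hα
  have hα0 : 0 < α := by linarith
  have hα1 : α < 1 := by
    have : ε < 1 / 2 := by
      by_contra! hc
      nlinarith
    linarith
  obtain ⟨k, hk, hle⟩ : ∃ k ≤ d, ∏ i ∈ range k, (α * ((K : ℝ) - i)) ≤
      Real.exp (chernoffLog α K ((K + d) / 2)) * ∏ i ∈ range k, (((K : ℝ) + d) / 2 - i) := by
    rcases hdK'.lt_or_eq with hlt | heq
    · refine exists_prod_le_exp_chernoffLog hα0 hα1 d K _ (by linarith) (by linarith) ?_ ?_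
      · nlinarith
      · nlinarith
    · refine ⟨d, le_rfl, le_of_eq ?_⟩
      have h2 : ((K : ℝ) + d) / 2 = K := by linarith
      have h3 : Real.exp (chernoffLog α K K) = α ^ d := by
        unfold chernoffLog
        rw [mul_div_assoc, div_self hK0.ne', sub_self, zero_mul, add_zero, mul_one, ← heq,
          Real.exp_nat_mul, Real.exp_log hα0]
      rw [h2, h3, prod_mul_distrib]
      simp
  have hkd : (k : ℝ) ≤ d := by exact_mod_cast hk
  have hpos : 0 < ∏ i ∈ range k, (((K : ℝ) + d) / 2 - i) := by
    refine prod_pos fun i hi => ?_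
    have : (i : ℝ) + 1 ≤ k := by exact_mod_cast mem_range.1 hi
    linarith
  have hsum : ∑ j, (((J j).numTrue ψ).descFactorial k : ℝ) ≤
      K.descFactorial k * (Fintype.card ι * α ^ k) := by
    rcases Nat.eq_zero_or_pos k with rfl | hk0
    · simp
    · exact hmoment k hk0 hk
  have hprod : (K.descFactorial k : ℝ) * α ^ k = ∏ i ∈ range k, (α * ((K : ℝ) - i)) := by
    rw [prod_mul_distrib, prod_const, card_range, mul_comm, Nat.descFactorial_eq_prod_range,
      Nat.cast_prod]
    congr 1
    refine prod_congr rfl fun i hi => ?_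
    rw [Nat.cast_sub ((mem_range.1 hi).le.trans (hk.trans hdK))]
  have hlow : (#{j | K + d ≤ 2 * (J j).numTrue ψ} : ℝ) *
      ∏ i ∈ range k, (((K : ℝ) + d) / 2 - i) ≤
        ∑ j, (((J j).numTrue ψ).descFactorial k : ℝ) := by
    rw [← nsmul_eq_mul]
    refine (card_nsmul_le_sum _ _ _ fun j hj => ?_).trans
      (sum_le_sum_of_subset_of_nonneg (filter_subset _ _) fun _ _ _ => by positivity)
    have hj' : ((K : ℝ) + d) ≤ 2 * (J j).numTrue ψ := by exact_mod_cast (mem_filter.1 hj).2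
    exact prod_sub_le_descFactorial (by linarith) (by linarith)
  refine le_of_mul_le_mul_right ?_ hpos
  calc _ ≤ (K.descFactorial k : ℝ) * (Fintype.card ι * α ^ k) := hlow.trans hsum
    _ = Fintype.card ι * ∏ i ∈ range k, (α * ((K : ℝ) - i)) := by rw [← hprod]; ring
    _ ≤ _ := by
        rw [mul_assoc]
        exact mul_le_mul_of_nonneg_left hle (by positivity)

end Tuples

/-- A univariate polynomial of degree at most `d` computing the parity of `K` signs from their sum,
whenever the sum has absolute value less than `d`. -/
lemma exists_polynomial_eval_eq_parity {K d : ℕ} (hd : d ≤ K) :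
    ∃ R : Polynomial ℝ, R.natDegree ≤ d ∧ ∀ M : ℕ, K < 2 * M + d → 2 * M < K + d →
      R.eval ((K : ℝ) - 2 * M) = (-1) ^ M := by
  set s : Finset ℕ := Ico ((K - d) / 2 + 1) ((K + d + 1) / 2) with hs
  set v : ℕ → ℝ := fun M => (K : ℝ) - 2 * M with hv
  have hinj : Set.InjOn v s := fun a _ b _ hab => by
    have : (a : ℝ) = b := by
      simp only [hv] at hab
      linarith
    exact_mod_cast this
  refine ⟨Lagrange.interpolate s v fun M => (-1) ^ M, ?_, fun M h1 h2 => ?_⟩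
  · refine Polynomial.natDegree_le_of_degree_le
      ((Lagrange.degree_interpolate_lt _ hinj).le.trans ?_)
    have : #s ≤ d := by
      rw [hs, Nat.card_Ico]
      omega
    exact_mod_cast this
  · refine Lagrange.eval_interpolate_at_node (v := v) _ hinj ?_
    rw [hs, mem_Ico]
    omega

lemma MvPolynomial.totalDegree_aeval_le {σ : Type*} (R : Polynomial ℝ) {p : MvPolynomial σ ℝ}
    (hp : p.totalDegree ≤ 1) : (Polynomial.aeval p R).totalDegree ≤ R.natDegree := by
  rw [Polynomial.aeval_eq_sum_range]
  refine MvPolynomial.totalDegree_finsetSum_le fun i hi => ?_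
  refine (MvPolynomial.totalDegree_smul_le _ _).trans ((MvPolynomial.totalDegree_pow _ _).trans ?_)
  have := mem_range.1 hi
  nlinarith

/-- pseudo-random labeled `(q,K)`-formulas with value `≥ 1−η` w.r.t. `MXOR`
are almost realized by a polynomial threshold function of degree `≤ d`. -/
theorem stmt13 (n K m q t d : ℕ) (hq : Odd q) (hn : 1 ≤ n) (hK : 1 ≤ K) (ht : t ≤ n)
    (hm : 1 ≤ m) (τ : ℝ) (hτ : 0 ≤ τ) (η : ℝ) (hη0 : 0 ≤ η) (hη1 : η ≤ 1)
    (C : Fin m → Fin q → KTuple n K) (y : Fin m → ℤˣ)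
    (hpr : PseudoRandom (fun jl : Fin m × Fin q => C jl.1 jl.2) t τ)
    (hd1 : 1 ≤ d) (hdt : d ≤ t) (hdK : d ≤ K)
    (hcond : (K : ℝ) * 2 ^ d * (n : ℝ) ^ d * τ / d < d)
    (ψ : Fin n → ℤˣ)
    (hψ : 1 - η ≤ (Nat.card {j : Fin m //
        rsign (∑ l, xorVal (C j l) ψ) = ((y j : ℤ) : ℝ)} : ℝ) / m) :
    ∃ p' : MvPolynomial (Fin q × Fin K × Fin n) ℝ, p'.totalDegree ≤ d ∧
      (Nat.card {j : Fin m //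
          rsign (MvPolynomial.eval (fun i => piMap (C j i.1) i.2) p') ≠ ((y j : ℤ) : ℝ)} : ℝ) / m
        ≤ η + 2 * q * Real.exp
            (-(klBer (1 / 2 + d / (2 * K))
                (1 / 2 + 2 ^ (d - 1) * (n : ℝ) ^ d * τ / d)) * K) := by
  obtain ⟨R, hRd, hR⟩ := exists_polynomial_eval_eq_parity hdK
  let lin : Fin q → MvPolynomial (Fin q × Fin K × Fin n) ℝ := fun l =>
    ∑ i : Fin K × Fin n, MvPolynomial.C ((ψ i.2 : ℤ) : ℝ) * MvPolynomial.X (l, i)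
  have hlin : ∀ l, (lin l).totalDegree ≤ 1 := fun l =>
    MvPolynomial.totalDegree_finsetSum_le fun i _ =>
      (MvPolynomial.totalDegree_mul _ _).trans
        (by rw [MvPolynomial.totalDegree_C, MvPolynomial.totalDegree_X])
  refine ⟨∑ l, Polynomial.aeval (lin l) R, MvPolynomial.totalDegree_finsetSum_le fun l _ =>
    (MvPolynomial.totalDegree_aeval_le R (hlin l)).trans hRd, ?_⟩
  have heval : ∀ j, MvPolynomial.eval (fun i => piMap (C j i.1) i.2)
      (∑ l, Polynomial.aeval (lin l) R) =
        ∑ l, R.eval ((K : ℝ) - 2 * (C j l).numTrue (-ψ)) := fun j => by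
    rw [map_sum]
    refine Finset.sum_congr rfl fun l _ => ?_
    rw [← MvPolynomial.coe_aeval_eq_eval, RingHom.coe_coe, ← Polynomial.aeval_algHom_apply,
      Polynomial.coe_aeval_eq_eval]
    congr 1
    rw [← sum_evalAt_eq, ← sum_piMap_mul]
    simp [lin]
  simp only [heval]
  set E := Real.exp (-(klBer (1 / 2 + d / (2 * K))
    (1 / 2 + 2 ^ (d - 1) * (n : ℝ) ^ d * τ / d)) * K) with hE
  have hm0 : (0 : ℝ) < m := by exact_mod_cast hm
  have htail := hpr.card_numTrue_ge_le hn hτ ht hd1 hdt hdK hcond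
  rw [← hE, Fintype.card_prod, Fintype.card_fin, Fintype.card_fin] at htail
  push_cast at htail
  rw [Nat.card_eq_fintype_card, Fintype.card_subtype, le_div_iff₀ hm0] at hψ
  rw [Nat.card_eq_fintype_card, Fintype.card_subtype, div_le_iff₀ hm0]
  set B : (Fin n → ℤˣ) → Finset (Fin m × Fin q) := fun φ =>
    {jl | K + d ≤ 2 * (C jl.1 jl.2).numTrue φ} with hB
  set G : Finset (Fin m) := {j | rsign (∑ l, xorVal (C j l) ψ) = ((y j : ℤ) : ℝ)} with hG
  have hsub : ({j | rsign (∑ l, R.eval ((K : ℝ) - 2 * (C j l).numTrue (-ψ))) ≠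
      ((y j : ℤ) : ℝ)} : Finset (Fin m)) ⊆ Gᶜ ∪ (B ψ ∪ B (-ψ)).image Prod.fst := by
    intro j hj
    simp only [Finset.mem_filter, Finset.mem_univ, true_and] at hj
    by_contra hnot
    simp only [Finset.mem_union, Finset.mem_compl, Finset.mem_image, not_or, not_not, not_exists,
      not_and, Prod.forall, hG, hB, Finset.mem_filter, Finset.mem_univ, true_and] at hnot
    refine hj (hnot.1 ▸ congrArg rsign (Finset.sum_congr rfl fun l _ => ?_))
    have hl : ¬ (K + d ≤ 2 * (C j l).numTrue ψ ∨ K + d ≤ 2 * (C j l).numTrue (-ψ)) :=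
      fun h => hnot.2 j l h rfl
    have hadd := (C j l).numTrue_add_numTrue_neg ψ
    rw [xorVal_eq, hR _ (by omega) (by omega)]
  have hcard := (Finset.card_le_card hsub).trans ((Finset.card_union_le _ _).trans
    (Nat.add_le_add_left (Finset.card_image_le.trans (Finset.card_union_le _ _)) _))
  rw [Finset.card_compl, Fintype.card_fin] at hcard
  have hGm : G.card ≤ m := by simpa using Finset.card_le_univ G
  have hcard' := (Nat.cast_le (α := ℝ)).2 hcard
  push_cast [Nat.cast_sub hGm] at hcard'
  have h1 := htail ψ
  have h2 := htail (-ψ)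
  linarith
end
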